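/- Let d ≥ 2 be an even integer, let γ' = (γ'_1,…,γ'_{d−1}) and Γ' = (Γ'_1,…,Γ'_{d−1}) be two left-handed Clifford families of size d−1 acting on ℂ^n with n = 2^{(d−2)/2}, and let b_1,…,b_d be nonzero real numbers. Set M = Σ_{j=1}^{d−1} b_j · (γ'_j ⊗ Γ'_j), |b| = Σ_{j=1}^{d} |b_j| and sgn(b) = Π_{j=1}^{d} sgn(b_j). Define the 2n²×2n² block matrices K_+ = [[0, −i(M − b_d·𝟙)],[i(M − b_d·𝟙), 0]] and K_− = [[0, −i(M + b_d·𝟙)],[i(M + b_d·𝟙), 0]], and let K = K_+ ⊕ K_− (block-diagonal). Then −|b| is an eigenvalue of K whose eigenspace is one-dimensional. Moreover, −|b| is an eigenvalue of K_+ and not of K_− if and only if either (sgn(b) = 1 and d ≡ 0 mod 4) or (sgn(b) = −1 and d ≡ 2 mod 4); in the remaining cases −|b| is an eigenvalue of K_− and not of K_+. -/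

import Mathlib

open Matrix

/-- The joint eigenspace of a family of matrices `S j` for the eigenvalues `ε j`. -/
def jointEigenspace {ι κ : Type*} [Fintype ι] (S : κ → Matrix ι ι ℂ) (ε : κ → ℂ) :
    Submodule ℂ (ι → ℂ) :=
  ⨅ j, LinearMap.ker ((S j).mulVecLin - ε j • LinearMap.id)

theorem mem_jointEigenspace {ι κ : Type*} [Fintype ι] {S : κ → Matrix ι ι ℂ} {ε : κ → ℂ}
    {w : ι → ℂ} : w ∈ jointEigenspace S ε ↔ ∀ j, S j *ᵥ w = ε j • w := by
  simp [jointEigenspace, sub_eq_zero]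

/-- The product of the projections `(1 + ε j S j) / 2` over a list of indices. -/
noncomputable def eigenProj {ι κ : Type*} [Fintype ι] [DecidableEq ι] (S : κ → Matrix ι ι ℂ)
    (ε : κ → ℂ) (l : List κ) : Matrix ι ι ℂ :=
  (l.map fun j => (1 / 2 : ℂ) • (1 + ε j • S j)).prod

section
variable {ι κ : Type*} [Fintype ι] [DecidableEq ι] {S : κ → Matrix ι ι ℂ} {ε : κ → ℂ}

theorem eigenProj_cons (j : κ) (l : List κ) :
    eigenProj S ε (j :: l) = ((1 / 2 : ℂ) • (1 + ε j • S j)) * eigenProj S ε l := by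
  simp [eigenProj]

theorem commute_eigenProj {A : Matrix ι ι ℂ} {l : List κ} (h : ∀ j ∈ l, Commute A (S j)) :
    Commute A (eigenProj S ε l) := by
  refine Commute.list_prod_right _ _ fun B hB => ?_
  obtain ⟨j, hj, rfl⟩ := List.mem_map.1 hB
  exact ((Commute.one_right A).add_right ((h j hj).smul_right _)).smul_right _

theorem eigenProj_mulVec_of_mem {w : ι → ℂ} (hε : ∀ j, ε j * ε j = 1)
    (hw : w ∈ jointEigenspace S ε) (l : List κ) : eigenProj S ε l *ᵥ w = w := by
  rw [mem_jointEigenspace] at hw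
  induction l with
  | nil => simp [eigenProj]
  | cons j l ih =>
    rw [eigenProj_cons, ← mulVec_mulVec, ih, smul_mulVec, add_mulVec, smul_mulVec, hw, smul_smul,
      hε, one_mulVec, one_smul, ← two_smul ℂ, smul_smul]
    norm_num

theorem mul_eigenProj (hcomm : ∀ i j, Commute (S i) (S j)) (hS : ∀ j, S j * S j = 1)
    (hε : ∀ j, ε j * ε j = 1) {j : κ} {l : List κ} (hj : j ∈ l) :
    S j * eigenProj S ε l = ε j • eigenProj S ε l := by
  induction l with
  | nil => simp at hj
  | cons i l ih =>
    rw [eigenProj_cons]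
    rcases List.mem_cons.1 hj with rfl | hj
    · rw [← mul_assoc, ← smul_mul_assoc]
      congr 1
      have h : ε j • (1 + ε j • S j) = S j * (1 + ε j • S j) := by
        rw [mul_add, mul_smul_comm, hS, smul_add, smul_smul, hε, mul_one, one_smul, add_comm]
      rw [mul_smul_comm, ← h, smul_comm]
    · have : Commute (S j) ((1 / 2 : ℂ) • (1 + ε i • S i)) :=
        ((Commute.one_right _).add_right ((hcomm j i).smul_right _)).smul_right _
      rw [← mul_assoc, this.eq, mul_assoc, ih hj, mul_smul_comm]

theorem trace_eigenProj {X : κ → Matrix ι ι ℂ} (hX : ∀ i, X i * X i = 1)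
    (hanti : ∀ i, X i * S i = -(S i * X i)) (hcommX : ∀ i j, i ≠ j → Commute (X i) (S j))
    {l : List κ} (hl : l.Nodup) :
    (eigenProj S ε l).trace = (Fintype.card ι : ℂ) / 2 ^ l.length := by
  induction l with
  | nil => simp [eigenProj]
  | cons i l ih =>
    obtain ⟨hi, hl⟩ := List.nodup_cons.1 hl
    have hQ : Commute (X i) (eigenProj S ε l) :=
      commute_eigenProj fun j hj => hcommX i j (by rintro rfl; exact hi hj)
    have h0 : (S i * eigenProj S ε l).trace = 0 := by
      have h1 : (S i * eigenProj S ε l).trace = -(S i * eigenProj S ε l).trace := by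
        calc (S i * eigenProj S ε l).trace
            = (X i * X i * (S i * eigenProj S ε l)).trace := by rw [hX, one_mul]
          _ = (X i * (S i * eigenProj S ε l) * X i).trace := by
            rw [mul_assoc, trace_mul_comm]
          _ = -(S i * eigenProj S ε l * (X i * X i)).trace := by
            rw [← mul_assoc (X i), hanti, neg_mul, neg_mul, trace_neg, mul_assoc (S i), hQ.eq]
            simp only [mul_assoc]
          _ = -(S i * eigenProj S ε l).trace := by rw [hX, mul_one]
      exact self_eq_neg.1 h1
    rw [eigenProj_cons, smul_mul_assoc, trace_smul, add_mul, one_mul, trace_add, smul_mul_assoc,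
      trace_smul, h0, ih hl, smul_zero, add_zero, List.length_cons, pow_succ, smul_eq_mul]
    field_simp

theorem finrank_jointEigenspace [Fintype κ] {X : κ → Matrix ι ι ℂ}
    (hcomm : ∀ i j, Commute (S i) (S j)) (hS : ∀ j, S j * S j = 1) (hε : ∀ j, ε j * ε j = 1)
    (hX : ∀ i, X i * X i = 1) (hanti : ∀ i, X i * S i = -(S i * X i))
    (hcommX : ∀ i j, i ≠ j → Commute (X i) (S j)) (hcard : Fintype.card ι = 2 ^ Fintype.card κ) :
    Module.finrank ℂ (jointEigenspace S ε) = 1 := by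
  set P := eigenProj S ε Finset.univ.toList with hP
  have hproj : LinearMap.IsProj (jointEigenspace S ε) (Matrix.toLin' P) := by
    refine ⟨fun w => mem_jointEigenspace.2 fun j => ?_, fun w hw => ?_⟩
    · rw [toLin'_apply, mulVec_mulVec, mul_eigenProj hcomm hS hε (by simp), smul_mulVec]
    · rw [toLin'_apply]
      exact eigenProj_mulVec_of_mem hε hw _
  have h := hproj.trace
  rw [Matrix.trace_toLin'_eq, trace_eigenProj hX hanti hcommX (Finset.nodup_toList _), hcard] at h
  simp at h
  exact_mod_cast h.symm

theorem ker_sum_smul_eq_jointEigenspace [Fintype κ] (b : κ → ℝ) (hb : ∀ j, b j ≠ 0)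
    (hsa : ∀ j, (S j)ᴴ = S j) (hS : ∀ j, S j * S j = 1) :
    LinearMap.ker (Matrix.mulVecLin (∑ j, (b j : ℂ) • S j - (-((∑ j, |b j| : ℝ) : ℂ)) • 1)) =
      jointEigenspace S fun j => -((Real.sign (b j) : ℝ) : ℂ) := by
  have hsq : ∀ j, ((Real.sign (b j) : ℝ) : ℂ) * ((Real.sign (b j) : ℝ) : ℂ) = 1 := fun j => by
    rcases Real.sign_apply_eq_of_ne_zero _ (hb j) with h | h <;> simp [h]
  have habs : ∀ j, ((|b j| : ℝ) : ℂ) * ((Real.sign (b j) : ℝ) : ℂ) = b j := fun j => by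
    rw [mul_comm]; 
    rcases (hb j).lt_or_gt with h | h
    · simp [Real.sign_of_neg h, abs_of_neg h]
    · simp [Real.sign_of_pos h, abs_of_pos h]
  set B : κ → Matrix ι ι ℂ := fun j => 1 + ((Real.sign (b j) : ℝ) : ℂ) • S j with hB
  have hBB : ∀ j, (B j)ᴴ * B j = (2 : ℂ) • B j := fun j => by
    simp only [hB, conjTranspose_add, conjTranspose_one, conjTranspose_smul, hsa]
    simp only [RCLike.star_def, Complex.conj_ofReal, mul_add, add_mul, mul_one, one_mul,
      smul_mul_smul_comm, hS, hsq, two_smul]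
    module
  have hsum : ∑ j, (b j : ℂ) • S j - (-((∑ j, |b j| : ℝ) : ℂ)) • 1 =
      ∑ j, ((|b j| : ℝ) : ℂ) • B j := by
    simp only [hB, smul_add, smul_smul, habs, Finset.sum_add_distrib, ← Finset.sum_smul]
    push_cast
    module
  have hmem : ∀ w j, S j *ᵥ w = (-((Real.sign (b j) : ℝ) : ℂ)) • w ↔ B j *ᵥ w = 0 := by
    intro w j
    simp only [hB, add_mulVec, one_mulVec, smul_mulVec]
    constructor
    · intro h
      rw [h, smul_smul, mul_neg, hsq]; simp
    · intro h
      have := congrArg (fun v => ((Real.sign (b j) : ℝ) : ℂ) • v) h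
      simp only [smul_add, smul_smul, hsq, one_smul, smul_zero] at this
      rw [neg_smul]
      exact eq_neg_of_add_eq_zero_right this
  ext w
  rw [mem_jointEigenspace, LinearMap.mem_ker, mulVecLin_apply, hsum, sum_mulVec]
  simp only [hmem, smul_mulVec]
  refine ⟨fun h => ?_, fun h => by simp [h]⟩
  have hpos : ∀ j, star w ⬝ᵥ B j *ᵥ w = ((1 / 2 : ℝ) : ℂ) * (star (B j *ᵥ w) ⬝ᵥ B j *ᵥ w) := by
    intro j
    rw [star_mulVec, ← dotProduct_mulVec, mulVec_mulVec, hBB, smul_mulVec, dotProduct_smul]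
    simp
  have h1 := congrArg (fun v => (star w ⬝ᵥ v).re) h
  simp only [dotProduct_sum, dotProduct_smul, hpos, dotProduct_zero, Complex.re_sum, smul_eq_mul,
    Complex.re_ofReal_mul, Complex.zero_re] at h1
  open ComplexOrder in
  have hnn : ∀ j, 0 ≤ (star (B j *ᵥ w) ⬝ᵥ B j *ᵥ w) := fun j => dotProduct_star_self_nonneg _
  intro j
  rw [Finset.sum_eq_zero_iff_of_nonneg fun j _ =>
    mul_nonneg (abs_nonneg _) (mul_nonneg (by norm_num) (Complex.le_def.1 (hnn j)).1)] at h1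
  have h2 := h1 j (Finset.mem_univ j)
  simp only [mul_eq_zero, abs_eq_zero, hb j, false_or] at h2
  refine dotProduct_star_self_eq_zero.1 (Complex.ext ?_ (Complex.le_def.1 (hnn j)).2.symm)
  simpa using h2
end

section
variable {α : Type*}

/-- The Kronecker product `σ_y ⊗ A` as a block matrix. -/
def sigmaY (A : Matrix α α ℂ) : Matrix (α ⊕ α) (α ⊕ α) ℂ :=
  fromBlocks 0 ((-Complex.I) • A) (Complex.I • A) 0

theorem conjTranspose_sigmaY (A : Matrix α α ℂ) : (sigmaY A)ᴴ = sigmaY Aᴴ := by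
  simp [sigmaY, fromBlocks_conjTranspose]

variable [Fintype α]

theorem sigmaY_mul_sigmaY (A B : Matrix α α ℂ) :
    sigmaY A * sigmaY B = fromBlocks (A * B) 0 0 (A * B) := by
  simp [sigmaY, fromBlocks_multiply, smul_smul]

variable [DecidableEq α]

theorem list_prod_map_sigmaY (l : List (Matrix α α ℂ)) :
    (l.map sigmaY).prod = if Even l.length then fromBlocks l.prod 0 0 l.prod
      else sigmaY l.prod := by
  induction l with
  | nil => simp
  | cons A l ih =>
    rw [List.map_cons, List.prod_cons, ih, List.length_cons, List.prod_cons]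
    by_cases h : Even l.length
    · simp [h, Nat.even_add_one, sigmaY, fromBlocks_multiply]
    · simp [h, Nat.even_add_one, sigmaY_mul_sigmaY]

theorem list_prod_map_fromBlocks_diag (l : List (Matrix α α ℂ)) :
    (l.map fun A => fromBlocks A 0 0 A).prod = fromBlocks l.prod 0 0 l.prod := by
  induction l with
  | nil => simp
  | cons A l ih => simp [ih, fromBlocks_multiply]

theorem list_prod_map_kronecker {β : Type*} [Fintype β] [DecidableEq β]
    (l : List (Matrix α α ℂ × Matrix β β ℂ)) :
    (l.map fun p => kroneckerMap (· * ·) p.1 p.2).prod =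
      kroneckerMap (· * ·) (l.map Prod.fst).prod (l.map Prod.snd).prod := by
  induction l with
  | nil => exact one_kronecker_one.symm
  | cons p l ih => simp only [List.map_cons, List.prod_cons, ih, mul_kronecker_mul]

theorem ofFn_prod_mulVec {m : ℕ} {S : Fin m → Matrix α α ℂ} {ε : Fin m → ℂ} {w : α → ℂ}
    (h : ∀ j, S j *ᵥ w = ε j • w) : (List.ofFn S).prod *ᵥ w = (∏ j, ε j) • w := by
  induction m with
  | zero => simp
  | succ m ih =>
    rw [List.ofFn_succ, List.prod_cons, ← mulVec_mulVec, ih fun j => h j.succ, mulVec_smul, h,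
      smul_smul, Fin.prod_univ_succ, mul_comm]

end

section
variable {m n : ℕ}

theorem clifford_square {γ : Fin m → Matrix (Fin n) (Fin n) ℂ}
    (hac : ∀ i j, γ i * γ j + γ j * γ i =
      if i = j then (2 : ℂ) • (1 : Matrix (Fin n) (Fin n) ℂ) else 0) (j : Fin m) :
    γ j * γ j = 1 := by
  have h := hac j j
  rw [if_pos rfl, ← two_smul ℂ] at h
  exact smul_right_injective _ two_ne_zero h

theorem clifford_anticomm {γ : Fin m → Matrix (Fin n) (Fin n) ℂ}
    (hac : ∀ i j, γ i * γ j + γ j * γ i =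
      if i = j then (2 : ℂ) • (1 : Matrix (Fin n) (Fin n) ℂ) else 0) {i j : Fin m} (hij : i ≠ j) :
    γ i * γ j = -(γ j * γ i) := by
  have h := hac i j
  rw [if_neg hij] at h
  exact eq_neg_of_add_eq_zero_left h

/-- The summands of the block matrix `K = Σ_j b_j S_j`. -/
def diracSummand (T : Fin m → Matrix (Fin n × Fin n) (Fin n × Fin n) ℂ) :
    Fin (m + 1) → Matrix (((Fin n × Fin n) ⊕ (Fin n × Fin n)) ⊕ ((Fin n × Fin n) ⊕ (Fin n × Fin n)))
      (((Fin n × Fin n) ⊕ (Fin n × Fin n)) ⊕ ((Fin n × Fin n) ⊕ (Fin n × Fin n))) ℂ :=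
  Fin.snoc (fun j => fromBlocks (sigmaY (T j)) 0 0 (sigmaY (T j)))
    (fromBlocks (sigmaY (-1)) 0 0 (sigmaY 1))

/-- Involutions each of which anticommutes with exactly one of the matrices `diracSummand`. -/
def diracFlip (g : Fin m → Matrix (Fin n × Fin n) (Fin n × Fin n) ℂ) :
    Fin (m + 1) → Matrix (((Fin n × Fin n) ⊕ (Fin n × Fin n)) ⊕ ((Fin n × Fin n) ⊕ (Fin n × Fin n)))
      (((Fin n × Fin n) ⊕ (Fin n × Fin n)) ⊕ ((Fin n × Fin n) ⊕ (Fin n × Fin n))) ℂ :=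
  Fin.snoc (fun j => fromBlocks 0 (fromBlocks 0 (g j) (g j) 0) (fromBlocks 0 (g j) (g j) 0) 0)
    (fromBlocks 0 1 1 0)

variable {T g : Fin m → Matrix (Fin n × Fin n) (Fin n × Fin n) ℂ}

theorem conjTranspose_diracSummand (hsa : ∀ j, (T j)ᴴ = T j) (j : Fin (m + 1)) :
    (diracSummand T j)ᴴ = diracSummand T j := by
  induction j using Fin.lastCases <;>
    simp [diracSummand, fromBlocks_conjTranspose, conjTranspose_sigmaY, hsa]

theorem diracSummand_mul_self (hT : ∀ j, T j * T j = 1) (j : Fin (m + 1)) :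
    diracSummand T j * diracSummand T j = 1 := by
  induction j using Fin.lastCases <;>
    simp [diracSummand, fromBlocks_multiply, sigmaY_mul_sigmaY, hT]

theorem commute_diracSummand (hT : ∀ i j, T i * T j = T j * T i) (i j : Fin (m + 1)) :
    Commute (diracSummand T i) (diracSummand T j) := by
  induction i using Fin.lastCases <;> induction j using Fin.lastCases <;>
    simp [diracSummand, fromBlocks_multiply, sigmaY_mul_sigmaY, Commute, SemiconjBy]
  exact hT _ _

theorem diracFlip_mul_self (hg : ∀ j, g j * g j = 1) (j : Fin (m + 1)) :
    diracFlip g j * diracFlip g j = 1 := by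
  induction j using Fin.lastCases <;> simp [diracFlip, fromBlocks_multiply, hg]

theorem diracFlip_anticomm (h : ∀ j, g j * T j = T j * g j) (j : Fin (m + 1)) :
    diracFlip g j * diracSummand T j = -(diracSummand T j * diracFlip g j) := by
  induction j using Fin.lastCases <;>
    simp [diracFlip, diracSummand, sigmaY, fromBlocks_multiply, fromBlocks_neg, h]

theorem diracFlip_commute (h : ∀ i j, i ≠ j → g i * T j = -(T j * g i)) (i j : Fin (m + 1))
    (hij : i ≠ j) : Commute (diracFlip g i) (diracSummand T j) := by
  induction i using Fin.lastCases with
  | last =>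
    induction j using Fin.lastCases with
    | last => exact absurd rfl hij
    | cast j =>
      simp [diracFlip, diracSummand, sigmaY, fromBlocks_multiply, Commute, SemiconjBy]
  | cast i =>
    induction j using Fin.lastCases with
    | last =>
      simp [diracFlip, diracSummand, sigmaY, fromBlocks_multiply, Commute, SemiconjBy]
    | cast j =>
      simp [diracFlip, diracSummand, sigmaY, fromBlocks_multiply, Commute, SemiconjBy,
        h i j (by rintro rfl; exact hij rfl)]

theorem ofFn_diracSummand_prod (hm : Odd m) :
    (List.ofFn (diracSummand T)).prod =
      fromBlocks (fromBlocks (-(List.ofFn T).prod) 0 0 (-(List.ofFn T).prod)) 0 0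
        (fromBlocks (List.ofFn T).prod 0 0 (List.ofFn T).prod) := by
  have h : (List.ofFn fun j : Fin m => diracSummand T j.castSucc) =
      ((List.ofFn T).map sigmaY).map fun A => fromBlocks A 0 0 A := by
    simp [List.map_ofFn, diracSummand, Function.comp_def]
  rw [List.ofFn_succ', List.concat_eq_append, List.prod_append, h, list_prod_map_fromBlocks_diag,
    list_prod_map_sigmaY, List.length_ofFn, if_neg (Nat.not_even_iff_odd.2 hm)]
  simp [diracSummand, fromBlocks_multiply, sigmaY_mul_sigmaY]

theorem ker_fromBlocks_diag {α : Type*} [Fintype α] [DecidableEq α]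
    (A B : Matrix α α ℂ) (a : ℂ) (w : α ⊕ α → ℂ) :
    w ∈ LinearMap.ker (mulVecLin (fromBlocks A 0 0 B - a • 1)) ↔
      w ∘ Sum.inl ∈ LinearMap.ker (mulVecLin (A - a • 1)) ∧
        w ∘ Sum.inr ∈ LinearMap.ker (mulVecLin (B - a • 1)) := by
  have : fromBlocks A 0 0 B - a • 1 = fromBlocks (A - a • 1) 0 0 (B - a • 1) := by
    rw [← fromBlocks_one, fromBlocks_smul, sub_eq_add_neg, fromBlocks_neg, fromBlocks_add]
    simp [sub_eq_add_neg]
  rw [this, LinearMap.mem_ker, mulVecLin_apply, fromBlocks_mulVec]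
  simp only [LinearMap.mem_ker, mulVecLin_apply, zero_mulVec, add_zero, zero_add]
  rw [← Sum.elim_zero_zero, Sum.elim_eq_iff]

end

/-- A simple eigenvalue of `Kp ⊕ Km` that is excluded from one block belongs to the other. -/
theorem extremal_eigenvalue_of_kernel {α : Type*} [Fintype α] [DecidableEq α]
    {Kp Km : Matrix α α ℂ} {a : ℂ} {p : Prop}
    (hfin : Module.finrank ℂ (LinearMap.ker (mulVecLin (fromBlocks Kp 0 0 Km - a • 1))) = 1)
    (hp : p → LinearMap.ker (mulVecLin (Km - a • 1)) = ⊥)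
    (hnp : ¬p → LinearMap.ker (mulVecLin (Kp - a • 1)) = ⊥) :
    ((LinearMap.ker (mulVecLin (Kp - a • 1)) ≠ ⊥ ∧ LinearMap.ker (mulVecLin (Km - a • 1)) = ⊥) ↔ p) ∧
      (¬p → (LinearMap.ker (mulVecLin (Km - a • 1)) ≠ ⊥ ∧
        LinearMap.ker (mulVecLin (Kp - a • 1)) = ⊥)) := by
  have hboth : ¬(LinearMap.ker (mulVecLin (Kp - a • 1)) = ⊥ ∧
      LinearMap.ker (mulVecLin (Km - a • 1)) = ⊥) := by
    rintro ⟨h1, h2⟩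
    have : LinearMap.ker (mulVecLin (fromBlocks Kp 0 0 Km - a • 1)) = ⊥ := by
      refine (Submodule.eq_bot_iff _).2 fun w hw => ?_
      rw [ker_fromBlocks_diag, h1, h2, Submodule.mem_bot, Submodule.mem_bot] at hw
      rw [← Sum.elim_comp_inl_inr w, hw.1, hw.2, Sum.elim_zero_zero]
    rw [this, finrank_bot] at hfin
    exact zero_ne_one hfin
  tauto

theorem smul_eq_smul_of_mem_jointEigenspace_diracSummand {m n : ℕ}
    {T : Fin m → Matrix (Fin n × Fin n) (Fin n × Fin n) ℂ} (hm : Odd m) {c e : ℂ}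
    (hc : (List.ofFn T).prod = c • 1) {ε : Fin (m + 1) → ℂ} (he : ∏ j, ε j = e)
    {u v : (Fin n × Fin n) ⊕ (Fin n × Fin n) → ℂ}
    (hw : Sum.elim u v ∈ jointEigenspace (diracSummand T) ε) :
    -c • u = e • u ∧ c • v = e • v := by
  have h := ofFn_prod_mulVec (mem_jointEigenspace.1 hw)
  have hneg : (-(c • 1) : Matrix (Fin n × Fin n) (Fin n × Fin n) ℂ) = -c • 1 := (neg_smul c 1).symm
  have hdiag : ∀ x : ℂ, fromBlocks (x • 1) 0 0 (x • 1) =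
      (x • 1 : Matrix ((Fin n × Fin n) ⊕ (Fin n × Fin n)) ((Fin n × Fin n) ⊕ (Fin n × Fin n)) ℂ) :=
    fun x => by rw [← fromBlocks_one, fromBlocks_smul, smul_zero]
  rw [ofFn_diracSummand_prod hm, he, hc, hneg, hdiag, hdiag, fromBlocks_mulVec] at h
  simp only [zero_mulVec, add_zero, zero_add, smul_mulVec, one_mulVec, Sum.elim_comp_inl,
    Sum.elim_comp_inr] at h
  exact ⟨funext fun i => congrFun h (Sum.inl i), funext fun i => congrFun h (Sum.inr i)⟩

theorem sum_smul_diracSummand {m n : ℕ}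
    (T : Fin m → Matrix (Fin n × Fin n) (Fin n × Fin n) ℂ) (b : Fin (m + 1) → ℂ) :
    ∑ j, b j • diracSummand T j =
      fromBlocks (sigmaY (∑ j : Fin m, b j.castSucc • T j - b (Fin.last m) • 1)) 0 0
        (sigmaY (∑ j : Fin m, b j.castSucc • T j + b (Fin.last m) • 1)) := by
  have h : ∀ s : Finset (Fin m), ∑ j ∈ s, b j.castSucc • diracSummand T j.castSucc =
      fromBlocks (sigmaY (∑ j ∈ s, b j.castSucc • T j)) 0 0
        (sigmaY (∑ j ∈ s, b j.castSucc • T j)) := by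
    intro s
    induction s using Finset.induction_on with
    | empty => simp [sigmaY]
    | insert i s hi ih =>
      rw [Finset.sum_insert hi, Finset.sum_insert hi, ih]
      simp [diracSummand, sigmaY, fromBlocks_smul, fromBlocks_add, smul_comm (b i.castSucc)]
  rw [Fin.sum_univ_castSucc, h]
  simp [diracSummand, sigmaY, fromBlocks_smul, fromBlocks_add, smul_comm (b (Fin.last m)),
    sub_eq_add_neg, add_comm]

theorem prod_neg_sign {m : ℕ} (hm : Odd m) (b : Fin (m + 1) → ℝ) :
    ∏ j, -((Real.sign (b j) : ℝ) : ℂ) = ((∏ j, Real.sign (b j) : ℝ) : ℂ) := by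
  rw [Finset.prod_neg, Finset.card_univ, Fintype.card_fin, hm.add_one.neg_one_pow]
  push_cast
  rw [one_mul]

/-- location of the simple eigenvalue `-|b|` of the block matrix
`K = K_+ ⊕ K_-` built from `M = Σ_{j<d} b_j (γ'_j ⊗ Γ'_j)` and `b_d`, for even `d`. -/
theorem dirac_extremal_eigenvalue
    (d : ℕ) (hd : Even d) (hd2 : 2 ≤ d) (n : ℕ) (hn : n = 2 ^ ((d - 2) / 2))
    (γ Γm : Fin (d - 1) → Matrix (Fin n) (Fin n) ℂ)
    (hγsa : ∀ j, (γ j)ᴴ = γ j)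
    (hγac : ∀ i j, γ i * γ j + γ j * γ i =
      if i = j then (2 : ℂ) • (1 : Matrix (Fin n) (Fin n) ℂ) else 0)
    (hγhand : (List.ofFn γ).prod =
      (Complex.I) ^ ((d - 1 - 1) / 2) • (1 : Matrix (Fin n) (Fin n) ℂ))
    (hΓsa : ∀ j, (Γm j)ᴴ = Γm j)
    (hΓac : ∀ i j, Γm i * Γm j + Γm j * Γm i =
      if i = j then (2 : ℂ) • (1 : Matrix (Fin n) (Fin n) ℂ) else 0)
    (hΓhand : (List.ofFn Γm).prod =
      (Complex.I) ^ ((d - 1 - 1) / 2) • (1 : Matrix (Fin n) (Fin n) ℂ))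
    (b : Fin d → ℝ) (hb : ∀ j, b j ≠ 0)
    (M : Matrix (Fin n × Fin n) (Fin n × Fin n) ℂ)
    (hM : M = ∑ j : Fin (d - 1),
      (b (Fin.castLE (Nat.sub_le d 1) j) : ℂ) • Matrix.kroneckerMap (· * ·) (γ j) (Γm j))
    (bd : ℝ) (hbd : bd = b ⟨d - 1, by omega⟩)
    (absB : ℝ) (habsB : absB = ∑ j, |b j|)
    (sgnB : ℝ) (hsgnB : sgnB = ∏ j, Real.sign (b j))
    (Kp Km : Matrix ((Fin n × Fin n) ⊕ (Fin n × Fin n)) ((Fin n × Fin n) ⊕ (Fin n × Fin n)) ℂ)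
    (hKp : Kp = Matrix.fromBlocks 0
      ((-Complex.I) • (M - (bd : ℂ) • (1 : Matrix (Fin n × Fin n) (Fin n × Fin n) ℂ)))
      (Complex.I • (M - (bd : ℂ) • (1 : Matrix (Fin n × Fin n) (Fin n × Fin n) ℂ))) 0)
    (hKm : Km = Matrix.fromBlocks 0
      ((-Complex.I) • (M + (bd : ℂ) • (1 : Matrix (Fin n × Fin n) (Fin n × Fin n) ℂ)))
      (Complex.I • (M + (bd : ℂ) • (1 : Matrix (Fin n × Fin n) (Fin n × Fin n) ℂ))) 0)
    (K : Matrix (((Fin n × Fin n) ⊕ (Fin n × Fin n)) ⊕ ((Fin n × Fin n) ⊕ (Fin n × Fin n)))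
        (((Fin n × Fin n) ⊕ (Fin n × Fin n)) ⊕ ((Fin n × Fin n) ⊕ (Fin n × Fin n))) ℂ)
    (hK : K = Matrix.fromBlocks Kp 0 0 Km) :
    Module.finrank ℂ ↥(LinearMap.ker (Matrix.mulVecLin (K - (-(absB : ℂ)) • 1))) = 1
    ∧ ((LinearMap.ker (Matrix.mulVecLin (Kp - (-(absB : ℂ)) • 1)) ≠ ⊥
          ∧ LinearMap.ker (Matrix.mulVecLin (Km - (-(absB : ℂ)) • 1)) = ⊥)
        ↔ ((sgnB = 1 ∧ d % 4 = 0) ∨ (sgnB = -1 ∧ d % 4 = 2)))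
    ∧ (¬ ((sgnB = 1 ∧ d % 4 = 0) ∨ (sgnB = -1 ∧ d % 4 = 2)) →
        (LinearMap.ker (Matrix.mulVecLin (Km - (-(absB : ℂ)) • 1)) ≠ ⊥
          ∧ LinearMap.ker (Matrix.mulVecLin (Kp - (-(absB : ℂ)) • 1)) = ⊥)) := by
  obtain ⟨k, rfl⟩ : ∃ k, d = 2 * k + 1 + 1 := by
    obtain ⟨r, rfl⟩ := hd
    exact ⟨r - 1, by omega⟩
  have hk : (2 * k + 1 + 1 - 2) / 2 = k := by omega
  have hk' : (2 * k + 1 + 1 - 1 - 1) / 2 = k := by omega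
  rw [hk] at hn
  rw [hk'] at hγhand hΓhand
  change Fin (2 * k + 1) → Matrix (Fin n) (Fin n) ℂ at γ Γm
  change ∀ j : Fin (2 * k + 1), _ at hγsa hΓsa
  change ∀ i j : Fin (2 * k + 1), _ at hγac hΓac
  have hodd : Odd (2 * k + 1) := ⟨k, rfl⟩
  set T : Fin (2 * k + 1) → Matrix (Fin n × Fin n) (Fin n × Fin n) ℂ :=
    fun j => kroneckerMap (· * ·) (γ j) (Γm j) with hT
  set g : Fin (2 * k + 1) → Matrix (Fin n × Fin n) (Fin n × Fin n) ℂ :=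
    fun j => kroneckerMap (· * ·) (γ j) 1 with hg
  have hTmul : ∀ i j, T i * T j = kroneckerMap (· * ·) (γ i * γ j) (Γm i * Γm j) := fun i j =>
    (mul_kronecker_mul _ _ _ _).symm
  have hgT : ∀ i j, g i * T j = kroneckerMap (· * ·) (γ i * γ j) (Γm j) := fun i j =>
    (mul_kronecker_mul _ _ _ _).symm.trans (by rw [one_mul])
  have hTg : ∀ i j, T j * g i = kroneckerMap (· * ·) (γ j * γ i) (Γm j) := fun i j =>
    (mul_kronecker_mul _ _ _ _).symm.trans (by rw [mul_one])
  have hTsa : ∀ j, (T j)ᴴ = T j := fun j => by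
    rw [hT]
    exact (conjTranspose_kronecker _ _).trans (by rw [hγsa, hΓsa])
  have hTsq : ∀ j, T j * T j = 1 := fun j => by
    rw [hTmul, clifford_square hγac, clifford_square hΓac]
    exact one_kronecker_one
  have hgsq : ∀ j, g j * g j = 1 := fun j => by
    refine (mul_kronecker_mul _ _ _ _).symm.trans ?_
    rw [clifford_square hγac, one_mul]
    exact one_kronecker_one
  have hTcomm : ∀ i j, T i * T j = T j * T i := fun i j => by
    rcases eq_or_ne i j with rfl | hij
    · rfl
    · rw [hTmul, hTmul, clifford_anticomm hγac hij, clifford_anticomm hΓac hij]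
      ext; simp
  have hganti : ∀ i j, i ≠ j → g i * T j = -(T j * g i) := fun i j hij => by
    rw [hgT, hTg, clifford_anticomm hγac hij]
    ext; simp
  have hprod : (List.ofFn T).prod = ((-1 : ℂ) ^ k) • 1 := by
    have h := list_prod_map_kronecker (List.ofFn fun j => (γ j, Γm j))
    simp only [List.map_ofFn, Function.comp_def] at h
    refine h.trans ?_
    change kroneckerMap (· * ·) (List.ofFn γ).prod (List.ofFn Γm).prod = _
    rw [hγhand, hΓhand]
    refine (smul_kronecker _ _ _).trans ?_
    rw [kronecker_smul, one_kronecker_one, smul_smul, ← mul_pow, Complex.I_mul_I]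
  have hKsum : K = ∑ j, (b j : ℂ) • diracSummand T j := by
    rw [sum_smul_diracSummand, hK, hKp, hKm, hM, hbd]
    rfl
  have hker := ker_sum_smul_eq_jointEigenspace (S := diracSummand T) b hb
    (conjTranspose_diracSummand hTsa) (diracSummand_mul_self hTsq)
  rw [← hKsum, ← habsB] at hker
  have hsign : ∀ j, -((Real.sign (b j) : ℝ) : ℂ) * -((Real.sign (b j) : ℝ) : ℂ) = 1 := fun j => by
    rcases Real.sign_apply_eq_of_ne_zero _ (hb j) with h | h <;> simp [h]
  have hfin : Module.finrank ℂ (LinearMap.ker (mulVecLin (K - (-(absB : ℂ)) • 1))) = 1 := by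
    rw [hker]
    refine finrank_jointEigenspace (commute_diracSummand hTcomm) (diracSummand_mul_self hTsq) hsign
      (diracFlip_mul_self hgsq) (diracFlip_anticomm fun j => by rw [hgT, hTg])
      (diracFlip_commute hganti) ?_
    simp only [Fintype.card_sum, Fintype.card_prod, Fintype.card_fin, hn]
    ring
  have hsgn : sgnB = 1 ∨ sgnB = -1 := by
    rw [hsgnB, ← mul_self_eq_one_iff, ← Finset.prod_mul_distrib]
    exact Finset.prod_eq_one fun j _ => by
      rcases Real.sign_apply_eq_of_ne_zero _ (hb j) with h | h <;> simp [h]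
  have hloc : ∀ u v, u ∈ LinearMap.ker (mulVecLin (Kp - (-(absB : ℂ)) • 1)) →
      v ∈ LinearMap.ker (mulVecLin (Km - (-(absB : ℂ)) • 1)) →
      -(-1 : ℂ) ^ k • u = (sgnB : ℂ) • u ∧ (-1 : ℂ) ^ k • v = (sgnB : ℂ) • v := by
    intro u v hu hv
    refine smul_eq_smul_of_mem_jointEigenspace_diracSummand hodd hprod
      ((prod_neg_sign hodd b).trans (by rw [hsgnB])) ?_
    rw [← hker, hK, ker_fromBlocks_diag]
    exact ⟨hu, hv⟩
  refine ⟨hfin, extremal_eigenvalue_of_kernel (hK ▸ hfin) (fun hp => ?_) fun hp => ?_⟩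
  · refine (Submodule.eq_bot_iff _).2 fun v hv => ?_
    have h := (hloc 0 v (zero_mem _) hv).2
    rcases hp with ⟨hs, hd4⟩ | ⟨hs, hd4⟩
    · rw [hs, Odd.neg_one_pow (Nat.odd_iff.2 (by omega))] at h
      exact self_eq_neg.1 (by simpa using h.symm)
    · rw [hs, Even.neg_one_pow (Nat.even_iff.2 (by omega))] at h
      exact self_eq_neg.1 (by simpa using h)
  · refine (Submodule.eq_bot_iff _).2 fun u hu => ?_
    have h := (hloc u 0 hu (zero_mem _)).1
    rcases hsgn with hs | hs <;> rcases Nat.even_or_odd k with hk2 | hk2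
    · rw [hs, hk2.neg_one_pow] at h
      exact self_eq_neg.1 (by simpa using h.symm)
    · exact absurd (Or.inl ⟨hs, by have := Nat.odd_iff.1 hk2; omega⟩) hp
    · exact absurd (Or.inr ⟨hs, by have := Nat.even_iff.1 hk2; omega⟩) hp
    · rw [hs, hk2.neg_one_pow] at h
      exact self_eq_neg.1 (by simpa using h)
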